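/- Let (V, ∇) be a vector bundle with connection over M. For k ≥ 2 define hol^k_M as the C^∞(M)-span of all sections ∇_{η_l}⋯∇_{η_3}(R(η_1,η_2)) of End(V) with 2 ≤ l ≤ k and η_i vector fields on M. Then [hol^k_M, hol^l_M] ⊆ hol^{k+l}_M, where the bracket is the pointwise commutator of endomorphisms. -/

import Mathlib

/-- Algebraic model of a smooth vector bundle `V` with connection `∇` over a smooth
manifold `M`: the commutative `ℝ`-algebra `A` plays the role of `C^∞(M)`, the
`A`-module `X` plays the role of the vector fields `𝔛(M)`, and the `A`-module `S`
plays the role of the smooth sections `Γ(V)`. -/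
structure ConnectionSetup (A X S : Type*) [CommRing A] [Algebra ℝ A]
    [AddCommGroup X] [Module A X]
    [AddCommGroup S] [Module ℝ S] [Module A S] [IsScalarTower ℝ A S]
    [SMulCommClass ℝ A S] where
  /-- the Lie bracket of vector fields -/
  lie : X → X → X
  /-- the action of vector fields on functions as derivations -/
  deriv : X → A → A
  deriv_mul : ∀ η (f g : A), deriv η (f * g) = deriv η f * g + f * deriv η g
  /-- the covariant derivative `∇` -/
  cov : X → Module.End ℝ S
  cov_add : ∀ η ξ, cov (η + ξ) = cov η + cov ξ
  cov_smul : ∀ (f : A) (η : X), cov (f • η) = f • cov η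
  cov_leibniz : ∀ (η : X) (f : A) (s : S), cov η (f • s) = deriv η f • s + f • cov η s

namespace ConnectionSetup

variable {A X S : Type*} [CommRing A] [Algebra ℝ A]
    [AddCommGroup X] [Module A X]
    [AddCommGroup S] [Module ℝ S] [Module A S] [IsScalarTower ℝ A S]
    [SMulCommClass ℝ A S]
variable (c : ConnectionSetup A X S)

/-- The curvature `R(η,ξ) = ∇_η∇_ξ - ∇_ξ∇_η - ∇_{[η,ξ]}` of the connection, viewed
as an endomorphism of the space of sections. -/
def curv (η ξ : X) : Module.End ℝ S :=
  c.cov η * c.cov ξ - c.cov ξ * c.cov η - c.cov (c.lie η ξ)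

/-- The induced covariant derivative on sections of `End V`:
`(∇_η E)(s) = ∇_η(E s) - E(∇_η s)`. -/
def covEnd (η : X) (E : Module.End ℝ S) : Module.End ℝ S :=
  c.cov η * E - E * c.cov η

/-- The iterated covariant derivative `∇_{η_k}⋯∇_{η_3}(R(η₁,η₂))` of a curvature
endomorphism, where `l = [η_k, …, η_3]`. -/
def iterD (l : List X) (η₁ η₂ : X) : Module.End ℝ S :=
  l.foldr c.covEnd (c.curv η₁ η₂)

/-- `hol^k_M`: the `C^∞(M)`-span of the iterated covariant derivatives
`∇_{η_l}⋯∇_{η_3}(R(η₁,η₂))` of curvature endomorphisms with `2 ≤ l ≤ k`. -/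
def holk (k : ℕ) : Submodule A (Module.End ℝ S) :=
  Submodule.span A
    {E | ∃ (l : List X) (η₁ η₂ : X), l.length + 2 ≤ k ∧ E = c.iterD l η₁ η₂}

end ConnectionSetup

namespace ConnectionSetup

section Symbol

variable {A S : Type*} [CommRing A] [AddCommGroup S] [Module ℝ S] [Module A S]

/-- `E` is a derivation of the `A`-module `S` over some map `D : A → A`. -/
def HasSymbol (A : Type*) {S : Type*} [CommRing A] [AddCommGroup S] [Module ℝ S] [Module A S]
    (E : Module.End ℝ S) : Prop :=
  ∃ D : A → A, ∀ (f : A) (s : S), E (f • s) = D f • s + f • E s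

theorem HasSymbol.sub {E F : Module.End ℝ S} (hE : HasSymbol A E) (hF : HasSymbol A F) :
    HasSymbol A (E - F) := by
  obtain ⟨D, hD⟩ := hE
  obtain ⟨D', hD'⟩ := hF
  refine ⟨fun f => D f - D' f, fun f s => ?_⟩
  simp only [LinearMap.sub_apply, hD, hD']
  module

theorem HasSymbol.add {E F : Module.End ℝ S} (hE : HasSymbol A E) (hF : HasSymbol A F) :
    HasSymbol A (E + F) := by
  obtain ⟨D, hD⟩ := hE
  obtain ⟨D', hD'⟩ := hF
  refine ⟨fun f => D f + D' f, fun f s => ?_⟩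
  simp only [LinearMap.add_apply, hD, hD']
  module

theorem HasSymbol.smul [SMulCommClass ℝ A S] (g : A) {E : Module.End ℝ S} (hE : HasSymbol A E) :
    HasSymbol A (g • E) := by
  obtain ⟨D, hD⟩ := hE
  refine ⟨fun f => g * D f, fun f s => ?_⟩
  simp only [LinearMap.smul_apply, hD]
  module

theorem HasSymbol.commutator {E F : Module.End ℝ S} (hE : HasSymbol A E)
    (hF : HasSymbol A F) : HasSymbol A (E * F - F * E) := by
  obtain ⟨D, hD⟩ := hE
  obtain ⟨D', hD'⟩ := hF
  refine ⟨fun f => D (D' f) - D' (D f), fun f s => ?_⟩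
  simp only [LinearMap.sub_apply, Module.End.mul_apply, hD, hD', map_add]
  module

end Symbol

variable {A X S : Type*} [CommRing A] [Algebra ℝ A]
    [AddCommGroup X] [Module A X]
    [AddCommGroup S] [Module ℝ S] [Module A S] [IsScalarTower ℝ A S]
    [SMulCommClass ℝ A S]
variable (c : ConnectionSetup A X S)

theorem hasSymbol_cov (η : X) : HasSymbol A (c.cov η) :=
  ⟨c.deriv η, c.cov_leibniz η⟩

theorem hasSymbol_iterD (L : List X) (a b : X) : HasSymbol A (c.iterD L a b) := by
  induction L with
  | nil =>
    exact ((c.hasSymbol_cov a).commutator (c.hasSymbol_cov b)).sub (c.hasSymbol_cov _)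
  | cons η L ih => exact (c.hasSymbol_cov η).commutator ih

theorem hasSymbol_of_mem_holk {k : ℕ} {E : Module.End ℝ S} (hE : E ∈ c.holk k) :
    HasSymbol A E := by
  refine Submodule.span_induction ?_ ⟨0, by simp⟩ (fun _ _ _ _ => HasSymbol.add)
    (fun g _ _ => HasSymbol.smul g) hE
  rintro _ ⟨L, a, b, -, rfl⟩
  exact c.hasSymbol_iterD L a b

theorem holk_mono : Monotone c.holk := fun _ _ h =>
  Submodule.span_mono fun _ ⟨L, a, b, hL, hE⟩ => ⟨L, a, b, hL.trans h, hE⟩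

theorem covEnd_smul (η : X) (f : A) (E : Module.End ℝ S) :
    c.covEnd η (f • E) = c.deriv η f • E + f • c.covEnd η E := by
  ext s
  simp only [covEnd, LinearMap.sub_apply, LinearMap.add_apply, LinearMap.smul_apply,
    Module.End.mul_apply, c.cov_leibniz]
  module

theorem covEnd_mem_holk (η : X) {k : ℕ} {E : Module.End ℝ S} (hE : E ∈ c.holk k) :
    c.covEnd η E ∈ c.holk (k + 1) := by
  induction hE using Submodule.span_induction with
  | mem E hE =>
    obtain ⟨L, a, b, hL, rfl⟩ := hE
    exact Submodule.subset_span ⟨η :: L, a, b, by simp only [List.length_cons]; omega, rfl⟩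
  | zero => simp [covEnd]
  | add E F _ _ hE hF =>
    have h : c.covEnd η (E + F) = c.covEnd η E + c.covEnd η F := by
      simp only [covEnd]
      noncomm_ring
    exact h ▸ add_mem hE hF
  | smul f E hE' hE =>
    rw [covEnd_smul]
    exact add_mem (Submodule.smul_mem _ _ (c.holk_mono k.le_succ hE')) (Submodule.smul_mem _ _ hE)

theorem commutator_iterD_mem_holk (L : List X) (a b : X) {l : ℕ} {F : Module.End ℝ S}
    (hF : F ∈ c.holk l) :
    c.iterD L a b * F - F * c.iterD L a b ∈ c.holk (L.length + 2 + l) := by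
  induction L generalizing l F with
  | nil =>
    have h : c.iterD [] a b * F - F * c.iterD [] a b =
        c.covEnd a (c.covEnd b F) - c.covEnd b (c.covEnd a F) - c.covEnd (c.lie a b) F := by
      simp only [iterD, List.foldr_nil, curv, covEnd]
      noncomm_ring
    have h₂ (η ξ : X) : c.covEnd η (c.covEnd ξ F) ∈ c.holk (0 + 2 + l) :=
      c.holk_mono (by omega) (c.covEnd_mem_holk η (c.covEnd_mem_holk ξ hF))
    rw [h]
    exact sub_mem (sub_mem (h₂ a b) (h₂ b a))
      (c.holk_mono (by simp only [List.length_nil]; omega) (c.covEnd_mem_holk _ hF))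
  | cons η L ih =>
    have h : c.iterD (η :: L) a b * F - F * c.iterD (η :: L) a b =
        c.covEnd η (c.iterD L a b * F - F * c.iterD L a b) -
          (c.iterD L a b * c.covEnd η F - c.covEnd η F * c.iterD L a b) := by
      simp only [iterD, List.foldr_cons, covEnd]
      noncomm_ring
    rw [h]
    exact sub_mem
      (c.holk_mono (by simp only [List.length_cons]; omega) (c.covEnd_mem_holk η (ih hF)))
      (c.holk_mono (by simp only [List.length_cons]; omega) (ih (c.covEnd_mem_holk η hF)))

end ConnectionSetup

/-- Let `(V,∇)` be a vector bundle with connection over `M`.  For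
`k ≥ 2`, `hol^k_M` is the `C^∞(M)`-span of all sections `∇_{η_l}⋯∇_{η_3}(R(η₁,η₂))`
of `End V` with `2 ≤ l ≤ k` and `η_i` vector fields on `M`.  Then
`[hol^k_M, hol^l_M] ⊆ hol^{k+l}_M`, where the bracket is the pointwise commutator of
endomorphisms. -/
theorem holk_bracket_subset
    {A X S : Type*} [CommRing A] [Algebra ℝ A]
    [AddCommGroup X] [Module A X]
    [AddCommGroup S] [Module ℝ S] [Module A S] [IsScalarTower ℝ A S]
    [SMulCommClass ℝ A S]
    (c : ConnectionSetup A X S)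
    (k l : ℕ) (hk : 2 ≤ k) (hl : 2 ≤ l) :
    ∀ E ∈ c.holk k, ∀ F ∈ c.holk l, E * F - F * E ∈ c.holk (k + l) := by
  intro E hE F hF
  induction hE using Submodule.span_induction with
  | mem E hE =>
    obtain ⟨L, a, b, hL, rfl⟩ := hE
    exact c.holk_mono (by omega) (c.commutator_iterD_mem_holk L a b hF)
  | zero => simp
  | add E E' _ _ hE hE' =>
    have h : (E + E') * F - F * (E + E') = (E * F - F * E) + (E' * F - F * E') := by
      noncomm_ring
    exact h ▸ add_mem hE hE'
  | smul f E hEk hE =>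
    obtain ⟨D, hD⟩ := c.hasSymbol_of_mem_holk hF
    have h : (f • E) * F - F * (f • E) = f • (E * F - F * E) - D f • E := by
      ext s
      simp only [LinearMap.sub_apply, LinearMap.smul_apply, Module.End.mul_apply, hD]
      module
    rw [h]
    exact sub_mem (Submodule.smul_mem _ _ hE)
      (Submodule.smul_mem _ _ (c.holk_mono (Nat.le_add_right k l) hEk))
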